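/- arXiv:1506.07380 — 2 statements merged into one kernel-verified Lean document; each statement's English description precedes it below -/
import Mathlib

section
/- For every bilocal model, setting I = ⟨(a¹_0 + a¹_1)/2 · a²_0 · (a³_0 + a³_1)/2⟩ and J = ⟨(a¹_0 − a¹_1)/2 · a²_1 · (a³_0 − a³_1)/2⟩, one has √|I| + √|J| ≤ 1 (the bilocal inequality). -/
open MeasureTheory

/-- A product response `f x * a x y * g y` with `|a| ≤ 1` has correlator bounded by the product of
the `L¹` norms of `f` and `g`, when `x` and `y` are independent. -/
theorem abs_integral_prod_mul_le {α β : Type*} [MeasurableSpace α] [MeasurableSpace β]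
    {μ : Measure α} {ν : Measure β} [SFinite μ] [SFinite ν]
    {f : α → ℝ} {g : β → ℝ} {a : α → β → ℝ} (hf : Integrable f μ) (hg : Integrable g ν)
    (ha : ∀ x y, |a x y| ≤ 1) :
    |∫ p, f p.1 * a p.1 p.2 * g p.2 ∂(μ.prod ν)| ≤ (∫ x, |f x| ∂μ) * ∫ y, |g y| ∂ν := by
  rw [← integral_prod_mul, ← Real.norm_eq_abs]
  refine norm_integral_le_of_norm_le (hf.abs.mul_prod hg.abs) (ae_of_all _ fun p => ?_)
  rw [Real.norm_eq_abs, abs_mul, abs_mul]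
  exact mul_le_mul_of_nonneg_right
    (mul_le_of_le_one_right (abs_nonneg _) (ha _ _)) (abs_nonneg _)

theorem integrable_of_eq_one_or_neg_one {α : Type*} [MeasurableSpace α] {μ : Measure α}
    [IsFiniteMeasure μ] {u : α → ℝ} (hu : Measurable u) (hu' : ∀ x, u x = 1 ∨ u x = -1) :
    Integrable u μ :=
  .of_bound hu.aestronglyMeasurable 1 <| ae_of_all _ fun x => by
    rcases hu' x with h | h <;> simp [h]

/-- For two `±1`-valued random variables, exactly one of the half-sum and the half-difference is
nonzero, and it has absolute value one. -/
theorem integral_abs_half_add_add_integral_abs_half_sub {α : Type*} [MeasurableSpace α]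
    {μ : Measure α} [IsProbabilityMeasure μ] {u v : α → ℝ}
    (hu : Measurable u) (hv : Measurable v)
    (hu' : ∀ x, u x = 1 ∨ u x = -1) (hv' : ∀ x, v x = 1 ∨ v x = -1) :
    (∫ x, |(u x + v x) / 2| ∂μ) + ∫ x, |(u x - v x) / 2| ∂μ = 1 := by
  have iu := integrable_of_eq_one_or_neg_one (μ := μ) hu hu'
  have iv := integrable_of_eq_one_or_neg_one (μ := μ) hv hv'
  have hadd := integral_add ((iu.add iv).div_const 2).abs ((iu.sub iv).div_const 2).abs
  simp only [Pi.add_apply, Pi.sub_apply] at hadd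
  rw [← hadd]
  have h (x : α) : |(u x + v x) / 2| + |(u x - v x) / 2| = 1 := by
    rcases hu' x with h | h <;> rcases hv' x with h' | h' <;> norm_num [h, h']
  simp [h]

theorem sqrt_le_half_add_of_le_mul {x p q : ℝ} (hp : 0 ≤ p) (hq : 0 ≤ q) (h : x ≤ p * q) :
    √x ≤ (p + q) / 2 :=
  Real.sqrt_le_iff.2 ⟨by positivity, by nlinarith [sq_nonneg (p - q)]⟩

/-- **The bilocal inequality.** For every bilocal model, setting
`I = ⟨(a¹_0+a¹_1)/2 · a²_0 · (a³_0+a³_1)/2⟩` and `J = ⟨(a¹_0−a¹_1)/2 · a²_1 · (a³_0−a³_1)/2⟩`,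
one has `√|I| + √|J| ≤ 1`. -/
theorem bilocal_inequality
    {Λ₁ Λ₂ : Type} [MeasurableSpace Λ₁] [MeasurableSpace Λ₂]
    (ρ₁ : Measure Λ₁) (ρ₂ : Measure Λ₂)
    [IsProbabilityMeasure ρ₁] [IsProbabilityMeasure ρ₂]
    (a₁ : Fin 2 → Λ₁ → ℝ) (a₂ : Fin 2 → Λ₁ → Λ₂ → ℝ) (a₃ : Fin 2 → Λ₂ → ℝ)
    (ha₁_meas : ∀ x, Measurable (a₁ x))
    (ha₂_meas : ∀ x, Measurable (fun p : Λ₁ × Λ₂ => a₂ x p.1 p.2))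
    (ha₃_meas : ∀ x, Measurable (a₃ x))
    (ha₁_val : ∀ x l₁, a₁ x l₁ = 1 ∨ a₁ x l₁ = -1)
    (ha₂_val : ∀ x l₁ l₂, a₂ x l₁ l₂ = 1 ∨ a₂ x l₁ l₂ = -1)
    (ha₃_val : ∀ x l₂, a₃ x l₂ = 1 ∨ a₃ x l₂ = -1)
    (I J : ℝ)
    (hI : I = ∫ p, ((a₁ 0 p.1 + a₁ 1 p.1) / 2) * a₂ 0 p.1 p.2
            * ((a₃ 0 p.2 + a₃ 1 p.2) / 2) ∂(ρ₁.prod ρ₂))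
    (hJ : J = ∫ p, ((a₁ 0 p.1 - a₁ 1 p.1) / 2) * a₂ 1 p.1 p.2
            * ((a₃ 0 p.2 - a₃ 1 p.2) / 2) ∂(ρ₁.prod ρ₂)) :
    Real.sqrt |I| + Real.sqrt |J| ≤ 1 := by
  have i₁ x := integrable_of_eq_one_or_neg_one (μ := ρ₁) (ha₁_meas x) (ha₁_val x)
  have i₃ x := integrable_of_eq_one_or_neg_one (μ := ρ₂) (ha₃_meas x) (ha₃_val x)
  have b₂ x l₁ l₂ : |a₂ x l₁ l₂| ≤ 1 := by
    rcases ha₂_val x l₁ l₂ with h | h <;> simp [h]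
  have nonneg {α : Type} [MeasurableSpace α] (μ : Measure α) (f : α → ℝ) : 0 ≤ ∫ x, |f x| ∂μ :=
    integral_nonneg fun _ => abs_nonneg _
  have sI := sqrt_le_half_add_of_le_mul (nonneg _ _) (nonneg _ _)
    (abs_integral_prod_mul_le (((i₁ 0).add (i₁ 1)).div_const 2)
      (((i₃ 0).add (i₃ 1)).div_const 2) (b₂ 0))
  have sJ := sqrt_le_half_add_of_le_mul (nonneg _ _) (nonneg _ _)
    (abs_integral_prod_mul_le (((i₁ 0).sub (i₁ 1)).div_const 2)
      (((i₃ 0).sub (i₃ 1)).div_const 2) (b₂ 1))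
  simp only [Pi.add_apply, Pi.sub_apply] at sI sJ
  rw [← hI] at sI
  rw [← hJ] at sJ
  linarith [integral_abs_half_add_add_integral_abs_half_sub (μ := ρ₁)
      (ha₁_meas 0) (ha₁_meas 1) (ha₁_val 0) (ha₁_val 1),
    integral_abs_half_add_add_integral_abs_half_sub (μ := ρ₂)
      (ha₃_meas 0) (ha₃_meas 1) (ha₃_val 0) (ha₃_val 1)]
end

section
/- For every bilocal model in which parties A¹ and A² each have three inputs {0,1,2} and party A³ has two inputs {0,1}, define I′ = ⟨(a¹_0 + a¹_1 + a¹_2 + 1) · a²_0 · (a³_0 + a³_1)/2⟩, J′ = ⟨(a¹_0 + a¹_1 − a¹_2 + 1) · a²_1 · (a³_0 − a³_1)/2⟩ + ⟨(a¹_0 − a¹_1) · a²_2 · (a³_0 − a³_1)/2⟩, and L′ = 4 + ⟨a¹_0⟩ + ⟨a¹_1⟩. Then √|I′| + √|J′| ≤ √L′. -/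
open MeasureTheory

/-- A response bounded by `1` cannot correlate the two independent sources more than the product
of the first absolute moments. -/
lemma abs_integral_prod_response_le {α β : Type*} [MeasurableSpace α] [MeasurableSpace β]
    {μ : Measure α} {ν : Measure β} [SFinite μ] [SFinite ν] {f : α → ℝ} {g : β → ℝ}
    {b : α → β → ℝ} (hf : Integrable f μ) (hg : Integrable g ν) (hb : ∀ x y, |b x y| ≤ 1) :
    |∫ p, f p.1 * b p.1 p.2 * g p.2 ∂(μ.prod ν)| ≤ (∫ x, |f x| ∂μ) * ∫ y, |g y| ∂ν := by
  rw [← integral_prod_mul (fun x => |f x|) (fun y => |g y|), ← Real.norm_eq_abs]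
  refine norm_integral_le_of_norm_le (hf.abs.mul_prod hg.abs) (.of_forall fun p => ?_)
  rw [Real.norm_eq_abs, abs_mul, abs_mul]
  exact mul_le_mul_of_nonneg_right
    (mul_le_of_le_one_right (abs_nonneg _) (hb p.1 p.2)) (abs_nonneg _)

lemma sqrt_mul_add_sqrt_mul_le {a b u v : ℝ} (ha : 0 ≤ a) (hb : 0 ≤ b) (hu : 0 ≤ u) (hv : 0 ≤ v)
    (huv : u + v = 1) : √(a * u) + √(b * v) ≤ √(a + b) := by
  apply Real.le_sqrt_of_sq_le
  rw [Real.sqrt_mul ha, Real.sqrt_mul hb]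
  calc (√a * √u + √b * √v) ^ 2 ≤ (√a ^ 2 + √b ^ 2) * (√u ^ 2 + √v ^ 2) := by
        nlinarith [sq_nonneg (√a * √v - √b * √u)]
    _ = a + b := by
        rw [Real.sq_sqrt ha, Real.sq_sqrt hb, Real.sq_sqrt hu, Real.sq_sqrt hv, huv, mul_one]

lemma integrable_of_eq_one_or_eq_neg_one {α : Type*} [MeasurableSpace α] {μ : Measure α}
    [IsFiniteMeasure μ] {f : α → ℝ} (hf : Measurable f) (hval : ∀ x, f x = 1 ∨ f x = -1) :
    Integrable f μ := by
  refine .of_bound hf.aestronglyMeasurable 1 (.of_forall fun x => ?_)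
  rcases hval x with h | h <;> simp [h]

/-- For every bilocal model in which parties `A¹` and `A²` each have three inputs `{0,1,2}`
and party `A³` has two inputs `{0,1}` (measurable ±1-valued responses), defining
`I′ = ⟨(a¹_0 + a¹_1 + a¹_2 + 1) · a²_0 · (a³_0 + a³_1)/2⟩`,
`J′ = ⟨(a¹_0 + a¹_1 − a¹_2 + 1) · a²_1 · (a³_0 − a³_1)/2⟩ + ⟨(a¹_0 − a¹_1) · a²_2 · (a³_0 − a³_1)/2⟩`,
`L′ = 4 + ⟨a¹_0⟩ + ⟨a¹_1⟩`, one has `√|I′| + √|J′| ≤ √L′`. -/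
theorem bilocal_I3322_inequality
    {Λ₁ Λ₂ : Type} [MeasurableSpace Λ₁] [MeasurableSpace Λ₂]
    (ρ₁ : Measure Λ₁) (ρ₂ : Measure Λ₂)
    [IsProbabilityMeasure ρ₁] [IsProbabilityMeasure ρ₂]
    (a₁ : Fin 3 → Λ₁ → ℝ) (a₂ : Fin 3 → Λ₁ → Λ₂ → ℝ) (a₃ : Fin 2 → Λ₂ → ℝ)
    (ha₁_meas : ∀ x, Measurable (a₁ x))
    (ha₂_meas : ∀ x, Measurable (fun p : Λ₁ × Λ₂ => a₂ x p.1 p.2))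
    (ha₃_meas : ∀ x, Measurable (a₃ x))
    (ha₁_val : ∀ x l₁, a₁ x l₁ = 1 ∨ a₁ x l₁ = -1)
    (ha₂_val : ∀ x l₁ l₂, a₂ x l₁ l₂ = 1 ∨ a₂ x l₁ l₂ = -1)
    (ha₃_val : ∀ x l₂, a₃ x l₂ = 1 ∨ a₃ x l₂ = -1)
    (I' J' L' : ℝ)
    (hI' : I' = ∫ p, (a₁ 0 p.1 + a₁ 1 p.1 + a₁ 2 p.1 + 1) * a₂ 0 p.1 p.2
        * ((a₃ 0 p.2 + a₃ 1 p.2) / 2) ∂(ρ₁.prod ρ₂))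
    (hJ' : J' = (∫ p, (a₁ 0 p.1 + a₁ 1 p.1 - a₁ 2 p.1 + 1) * a₂ 1 p.1 p.2
          * ((a₃ 0 p.2 - a₃ 1 p.2) / 2) ∂(ρ₁.prod ρ₂))
        + (∫ p, (a₁ 0 p.1 - a₁ 1 p.1) * a₂ 2 p.1 p.2
          * ((a₃ 0 p.2 - a₃ 1 p.2) / 2) ∂(ρ₁.prod ρ₂)))
    (hL' : L' = 4 + (∫ l₁, a₁ 0 l₁ ∂ρ₁) + (∫ l₁, a₁ 1 l₁ ∂ρ₁)) :
    Real.sqrt |I'| + Real.sqrt |J'| ≤ Real.sqrt L' := by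
  have i₁ : ∀ x, Integrable (a₁ x) ρ₁ := fun x =>
    integrable_of_eq_one_or_eq_neg_one (ha₁_meas x) (ha₁_val x)
  have i₃ : ∀ x, Integrable (a₃ x) ρ₂ := fun x =>
    integrable_of_eq_one_or_eq_neg_one (ha₃_meas x) (ha₃_val x)
  have hb : ∀ x l₁ l₂, |a₂ x l₁ l₂| ≤ 1 := fun x l₁ l₂ => by
    rcases ha₂_val x l₁ l₂ with h | h <;> simp [h]
  have iA : Integrable (fun l => a₁ 0 l + a₁ 1 l + a₁ 2 l + 1) ρ₁ :=
    (((i₁ 0).add (i₁ 1)).add (i₁ 2)).add (integrable_const 1)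
  have iB : Integrable (fun l => a₁ 0 l + a₁ 1 l - a₁ 2 l + 1) ρ₁ :=
    (((i₁ 0).add (i₁ 1)).sub (i₁ 2)).add (integrable_const 1)
  have iC : Integrable (fun l => a₁ 0 l - a₁ 1 l) ρ₁ := (i₁ 0).sub (i₁ 1)
  have iP : Integrable (fun l => (a₃ 0 l + a₃ 1 l) / 2) ρ₂ := ((i₃ 0).add (i₃ 1)).div_const 2
  have iM : Integrable (fun l => (a₃ 0 l - a₃ 1 l) / 2) ρ₂ := ((i₃ 0).sub (i₃ 1)).div_const 2
  have hI := abs_integral_prod_response_le iA iP (hb 0)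
  have hJ₁ := abs_integral_prod_response_le iB iM (hb 1)
  have hJ₂ := abs_integral_prod_response_le iC iM (hb 2)
  have huv : (∫ l, |(a₃ 0 l + a₃ 1 l) / 2| ∂ρ₂) + ∫ l, |(a₃ 0 l - a₃ 1 l) / 2| ∂ρ₂ = 1 := by
    rw [← integral_add iP.abs iM.abs]
    have h : ∀ l, |(a₃ 0 l + a₃ 1 l) / 2| + |(a₃ 0 l - a₃ 1 l) / 2| = 1 := fun l => by
      rcases ha₃_val 0 l with h0 | h0 <;> rcases ha₃_val 1 l with h1 | h1 <;>
        rw [h0, h1] <;> norm_num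
    simp [h]
  have hL : L' = (∫ l, |a₁ 0 l + a₁ 1 l + a₁ 2 l + 1| ∂ρ₁)
      + ((∫ l, |a₁ 0 l + a₁ 1 l - a₁ 2 l + 1| ∂ρ₁) + ∫ l, |a₁ 0 l - a₁ 1 l| ∂ρ₁) := by
    have h : ∀ l, |a₁ 0 l + a₁ 1 l + a₁ 2 l + 1|
        + (|a₁ 0 l + a₁ 1 l - a₁ 2 l + 1| + |a₁ 0 l - a₁ 1 l|) = 4 + (a₁ 0 l + a₁ 1 l) :=
      fun l => by
        rcases ha₁_val 0 l with h0 | h0 <;> rcases ha₁_val 1 l with h1 | h1 <;>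
          rcases ha₁_val 2 l with h2 | h2 <;> rw [h0, h1, h2] <;> norm_num
    have iBC : Integrable (fun l => |a₁ 0 l + a₁ 1 l - a₁ 2 l + 1| + |a₁ 0 l - a₁ 1 l|) ρ₁ :=
      iB.abs.add iC.abs
    have iS : Integrable (fun l => a₁ 0 l + a₁ 1 l) ρ₁ := (i₁ 0).add (i₁ 1)
    rw [← integral_add iB.abs iC.abs, ← integral_add iA.abs iBC,
      integral_congr_ae (.of_forall h), integral_add (integrable_const 4) iS,
      integral_add (i₁ 0) (i₁ 1), hL']
    simp [add_assoc]
  rw [← hI'] at hI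
  have hJ : |J'| ≤ ((∫ l, |a₁ 0 l + a₁ 1 l - a₁ 2 l + 1| ∂ρ₁) + ∫ l, |a₁ 0 l - a₁ 1 l| ∂ρ₁)
      * ∫ l, |(a₃ 0 l - a₃ 1 l) / 2| ∂ρ₂ := by
    rw [hJ', add_mul]
    exact (abs_add_le _ _).trans (add_le_add hJ₁ hJ₂)
  rw [hL]
  exact (add_le_add (Real.sqrt_le_sqrt hI) (Real.sqrt_le_sqrt hJ)).trans
    (sqrt_mul_add_sqrt_mul_le (by positivity) (by positivity) (by positivity) (by positivity) huv)
end
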